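/- arXiv:0912.0975 — 4 statements merged into one kernel-verified Lean document; each statement's English description precedes it below -/
import Mathlib

section
/- Let n ≥ 1, let v_a, v_b : Fin n → ℝ be two vectors, and let p_a, p_b be permutations of Fin n such that v_a ∘ p_a and v_b ∘ p_b are monotone nondecreasing (i.e., p_a sorts v_a and p_b sorts v_b in increasing order). Suppose p, q : Fin n satisfy p_a p = p_b q (the (p+1)-st smallest element of v_a has the same index as the (q+1)-st smallest element of v_b). Then for every x : Fin n there exists an index y belonging to the set {p_a j : j ≤ p} ∪ {p_b j : j ≤ q} such that v_a y + v_b y ≤ v_a x + v_b x; that is, the minimum of v_a i + v_b i over all i is attained within the first p+1 smallest values of v_a together with the first q+1 smallest values of v_b. -/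
/-- If `p_a` sorts `v_a` and `p_b` sorts `v_b` in increasing order, and the
`(p+1)`-st smallest element of `v_a` has the same index as the `(q+1)`-st smallest element of
`v_b` (i.e. `p_a p = p_b q`), then the minimum of `v_a i + v_b i` is attained among the first
`p+1` smallest values of `v_a` together with the first `q+1` smallest values of `v_b`. -/
theorem stmt0 (n : ℕ) (hn : 1 ≤ n) (va vb : Fin n → ℝ) (pa pb : Equiv.Perm (Fin n))
    (ha : Monotone (va ∘ pa)) (hb : Monotone (vb ∘ pb))
    (p q : Fin n) (hpq : pa p = pb q) (x : Fin n) :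
    ∃ y : Fin n,
      (y ∈ {z : Fin n | ∃ j : Fin n, j ≤ p ∧ z = pa j} ∪
            {z : Fin n | ∃ j : Fin n, j ≤ q ∧ z = pb j}) ∧
      va y + vb y ≤ va x + vb x := by
  by_cases hxa : pa.symm x ≤ p
  · exact ⟨x, Or.inl ⟨pa.symm x, hxa, by simp⟩, le_rfl⟩
  by_cases hxb : pb.symm x ≤ q
  · exact ⟨x, Or.inr ⟨pb.symm x, hxb, by simp⟩, le_rfl⟩
  refine ⟨pa p, Or.inl ⟨p, le_rfl, rfl⟩, add_le_add ?_ ?_⟩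
  · simpa using ha (not_le.mp hxa).le
  · simpa [hpq] using hb (not_le.mp hxb).le
end

section
/- Let n ≥ 1 and let e : Fin n → Fin n → ℝ be edge weights on the complete directed graph on n vertices satisfying e u u = 0 for all u. Define matrices A_i : Fin n → Fin n → ℝ recursively by A_0 = e and A_{i+1} u v = min over x : Fin n of (A_i u x + A_i x v). Then for every i ∈ ℕ and all u, v : Fin n, A_i u v equals D (2^i) u v, the minimum weight over all walks from u to v using at most 2^i edges. -/
/-- The weight of the walk that starts at `u` and then visits the vertices of `xs` in order. -/
noncomputable def walkWeight {n : ℕ} (e : Fin n → Fin n → ℝ) : Fin n → List (Fin n) → ℝ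
  | _, [] => 0
  | u, x :: xs => e u x + walkWeight e x xs

/-- The set of weights of walks from `u` to `v` using at most `k` edges. -/
def walkWeights {n : ℕ} (e : Fin n → Fin n → ℝ) (k : ℕ) (u v : Fin n) : Set ℝ :=
  {w | ∃ xs : List (Fin n), xs.length ≤ k ∧
        (u :: xs).getLast (List.cons_ne_nil u xs) = v ∧ w = walkWeight e u xs}

/-- `D e k u v` is the minimum weight over all walks from `u` to `v` with at most `k` edges. -/
noncomputable def D {n : ℕ} (e : Fin n → Fin n → ℝ) (k : ℕ) (u v : Fin n) : ℝ :=
  sInf (walkWeights e k u v)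

/-- The repeated-squaring recursion: `A 0 = e` and
`A (i+1) u v = min over x of (A i u x + A i x v)`. -/
noncomputable def A {n : ℕ} (e : Fin n → Fin n → ℝ) : ℕ → Fin n → Fin n → ℝ
  | 0 => e
  | i + 1 => fun u v => ⨅ x : Fin n, (A e i u x + A e i x v)

theorem getLast_cons_append {α : Type*} (u : α) (xs ys : List α) :
    (u :: (xs ++ ys)).getLast (List.cons_ne_nil _ _) =
      ((u :: xs).getLast (List.cons_ne_nil _ _) :: ys).getLast (List.cons_ne_nil _ _) := by
  induction xs generalizing u with
  | nil => simp
  | cons x xs ih => simpa using ih x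

theorem walkWeight_append {n : ℕ} (e : Fin n → Fin n → ℝ) (u : Fin n) (xs ys : List (Fin n)) :
    walkWeight e u (xs ++ ys) =
      walkWeight e u xs + walkWeight e ((u :: xs).getLast (List.cons_ne_nil _ _)) ys := by
  induction xs generalizing u with
  | nil => simp [walkWeight]
  | cons x xs ih => simp [walkWeight, ih x, add_assoc]

theorem isLeast_walkWeights_one {n : ℕ} (e : Fin n → Fin n → ℝ) (he : ∀ u : Fin n, e u u = 0)
    (u v : Fin n) : IsLeast (walkWeights e 1 u v) (e u v) := by
  refine ⟨⟨[v], by simp, by simp, by simp [walkWeight]⟩, ?_⟩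
  rintro w ⟨xs, hlen, hlast, rfl⟩
  match xs, hlen, hlast with
  | [], _, hlast =>
    obtain rfl : u = v := by simpa using hlast
    simp [walkWeight, he]
  | [x], _, hlast =>
    obtain rfl : x = v := by simpa using hlast
    simp [walkWeight]

/-- Min-plus products of minimal walk weights are minimal: a walk with at most `k + l` edges is
a walk with at most `k` edges followed by one with at most `l` edges. -/
theorem isLeast_walkWeights_add {n : ℕ} {e : Fin n → Fin n → ℝ} {k l : ℕ}
    {B C : Fin n → Fin n → ℝ} (hB : ∀ u v, IsLeast (walkWeights e k u v) (B u v))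
    (hC : ∀ u v, IsLeast (walkWeights e l u v) (C u v)) (u v : Fin n) :
    IsLeast (walkWeights e (k + l) u v) (⨅ x, (B u x + C x v)) := by
  constructor
  · have : Nonempty (Fin n) := ⟨u⟩
    obtain ⟨x, hx⟩ := exists_eq_ciInf_of_finite (f := fun x => B u x + C x v)
    obtain ⟨xs, hxs, rfl, hBw⟩ := (hB u x).1
    obtain ⟨ys, hys, hlast, hCw⟩ := (hC _ v).1
    refine ⟨xs ++ ys, by simp; omega, by rw [getLast_cons_append, hlast], ?_⟩
    rw [walkWeight_append, ← hx, hBw, hCw]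
  · rintro w ⟨xs, hlen, hlast, rfl⟩
    rw [← List.take_append_drop k xs, walkWeight_append]
    refine (ciInf_le (Set.finite_range _).bddBelow _).trans
      (add_le_add ((hB u _).2 ⟨xs.take k, by simp, rfl, rfl⟩)
        ((hC _ v).2 ⟨xs.drop k, by simp; omega, ?_, rfl⟩))
    rw [← getLast_cons_append]
    simpa using hlast

theorem isLeast_walkWeights_two_pow {n : ℕ} (e : Fin n → Fin n → ℝ)
    (he : ∀ u : Fin n, e u u = 0) (i : ℕ) (u v : Fin n) :
    IsLeast (walkWeights e (2 ^ i) u v) (A e i u v) := by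
  induction i generalizing u v with
  | zero => simpa [A] using isLeast_walkWeights_one e he u v
  | succ i ih =>
    rw [pow_succ, mul_two]
    exact isLeast_walkWeights_add ih ih u v

/-- if `e u u = 0` for all `u`, then for every `i`, `A i u v` equals
`D (2^i) u v`, the minimum weight over walks from `u` to `v` with at most `2^i` edges. -/
theorem stmt3 (n : ℕ) (hn : 1 ≤ n) (e : Fin n → Fin n → ℝ) (he : ∀ u : Fin n, e u u = 0)
    (i : ℕ) (u v : Fin n) :
    A e i u v = D e (2 ^ i) u v := by
  exact (isLeast_walkWeights_two_pow e he i u v).csInf_eq.symm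
end

section
/- Let V, m ∈ ℕ with 2m ≤ V. The number of permutations σ of Fin V such that σ i ≥ m for every i < m equals (V − m)! · (V − m)!/(V − 2m)!, i.e., the cardinality of {σ ∈ Equiv.Perm (Fin V) | ∀ i < m, m ≤ σ i} equals (V − m)! * Nat.descFactorial (V − m) m. Equivalently, for a uniformly random permutation, P(M(σ) > m) = (V − m)!·(V − m)!/((V − 2m)!·V!). -/
open Finset in
/-- An injection of a subtype of a finite type `α` into `α` extends to exactly
`(card {a // ¬ p a})!` permutations of `α`. -/
theorem card_perm_extending {α : Type*} [Fintype α] [DecidableEq α] (p : α → Prop)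
    [DecidablePred p] (f : {a // p a} ↪ α) :
    #{σ : Equiv.Perm α | ∀ a : {a // p a}, σ a = f a} =
      (Fintype.card {a // ¬ p a}).factorial := by
  classical
  let s : Set α := {a | p a}
  let e : s ≃ Set.range f := Equiv.ofInjective f f.injective
  have hcompl : Fintype.card (sᶜ : Set α) = Fintype.card ((Set.range f)ᶜ : Set α) := by
    rw [Fintype.card_compl_set, Fintype.card_compl_set, Fintype.card_congr e]
  calc #{σ : Equiv.Perm α | ∀ a : {a // p a}, σ a = f a}
      = Fintype.card {σ : Equiv.Perm α // ∀ a : s, σ a = e a} :=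
        (Fintype.card_subtype _).symm
    _ = Fintype.card ((sᶜ : Set α) ≃ ((Set.range f)ᶜ : Set α)) :=
        Fintype.card_congr (Equiv.Set.compl e)
    _ = (Fintype.card (sᶜ : Set α)).factorial :=
        Fintype.card_equiv (Fintype.equivOfCardEq hcompl)
    _ = (Fintype.card {a // ¬ p a}).factorial :=
        congrArg Nat.factorial (Fintype.card_congr (Equiv.refl _))

open Finset in
/-- The number of permutations of a finite type that send every element satisfying `p` to an
element satisfying `q`. -/
theorem card_perm_mapping_subtype {α : Type*} [Fintype α] [DecidableEq α] (p q : α → Prop)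
    [DecidablePred p] [DecidablePred q] :
    #{σ : Equiv.Perm α | ∀ a, p a → q (σ a)} =
      (Fintype.card {a // ¬ p a}).factorial *
        (Fintype.card {a // q a}).descFactorial (Fintype.card {a // p a}) := by
  let restrict (σ : Equiv.Perm α) : {a // p a} ↪ α :=
    (Function.Embedding.subtype p).trans σ.toEmbedding
  let T : Finset ({a // p a} ↪ α) :=
    univ.map ⟨fun g : {a // p a} ↪ {a // q a} => g.trans (Function.Embedding.subtype q),
      fun g g' hg => by
        ext a
        exact DFunLike.congr_fun hg a⟩
  have hT (f : {a // p a} ↪ α) : f ∈ T ↔ ∀ a, q (f a) := by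
    simp only [T, mem_map, mem_univ, true_and]
    constructor
    · rintro ⟨g, rfl⟩ a
      exact (g a).2
    · intro hf
      exact ⟨f.codRestrict {a | q a} hf, rfl⟩
  have hfiber : ∀ f ∈ T, #{σ ∈ {σ : Equiv.Perm α | ∀ a, p a → q (σ a)} | restrict σ = f} =
      (Fintype.card {a // ¬ p a}).factorial := by
    intro f hf
    rw [hT] at hf
    rw [← card_perm_extending p f, filter_filter]
    congr 1
    ext σ
    simp only [mem_filter, mem_univ, true_and, DFunLike.ext_iff]
    refine ⟨fun hσ => hσ.2, fun hσ => ⟨fun a ha => ?_, hσ⟩⟩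
    have := hf ⟨a, ha⟩
    rwa [← hσ ⟨a, ha⟩] at this
  rw [card_eq_sum_card_fiberwise (f := restrict) (t := T), sum_congr rfl hfiber, sum_const,
    card_map, card_univ, Fintype.card_embedding_eq, smul_eq_mul, mul_comm]
  intro σ hσ
  simp only [coe_filter, mem_univ, true_and, Set.mem_ofPred_eq] at hσ
  exact (hT _).2 fun a => hσ a a.2

/-- for `2m ≤ V`, the number of permutations `σ` of `Fin V` whose top-left
`m × m` square is empty (i.e. `σ i ≥ m` for every `i < m`) equals
`(V - m)! · (V - m)!/(V - 2m)! = (V - m)! · descFactorial (V - m) m`; equivalently, for a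
uniform random permutation, `P(M(σ) > m) = (V - m)!·(V - m)!/((V - 2m)!·V!)`. -/
theorem stmt7 (V m : ℕ) (h : 2 * m ≤ V) :
    (Finset.univ.filter fun σ : Equiv.Perm (Fin V) =>
        ∀ i : Fin V, (i : ℕ) < m → m ≤ (σ i : ℕ)).card =
      Nat.factorial (V - m) * Nat.descFactorial (V - m) m := by
  have hlt : Fintype.card {i : Fin V // (i : ℕ) < m} = m := by
    rw [Fintype.card_subtype, Fin.card_filter_val_lt]
    omega
  have hnot : Fintype.card {i : Fin V // ¬ (i : ℕ) < m} = V - m := by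
    rw [Fintype.card_subtype_compl, hlt, Fintype.card_fin]
  have hle : Fintype.card {i : Fin V // m ≤ (i : ℕ)} = V - m := by
    simpa only [not_lt] using hnot
  have hcard := card_perm_mapping_subtype (fun i : Fin V => (i : ℕ) < m) (fun i => m ≤ (i : ℕ))
  rw [hlt, hnot, hle] at hcard
  convert hcard
end

section
/- For every V ≥ 1, the real sum Σ_{m=0}^{V} ((V − m)/V)^m is at most 2·√V + 1. -/
lemma one_sub_div_pow_le_exp {V m : ℕ} (hV : 1 ≤ V) (hm : m ≤ V) :
    (((V : ℝ) - m) / V) ^ m ≤ Real.exp (-(1 / (V : ℝ)) * (m : ℝ) ^ 2) := by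
  have hV0 : (0 : ℝ) < V := by exact_mod_cast hV
  have hmV : (m : ℝ) ≤ V := by exact_mod_cast hm
  have h0 : 0 ≤ ((V : ℝ) - m) / V := div_nonneg (sub_nonneg.2 hmV) hV0.le
  have h1 : ((V : ℝ) - m) / V ≤ Real.exp (-(m / V : ℝ)) := by
    rw [sub_div, div_self hV0.ne']
    exact Real.one_sub_le_exp_neg _
  calc (((V : ℝ) - m) / V) ^ m ≤ Real.exp (-(m / V : ℝ)) ^ m := by gcongr
    _ = Real.exp (-(1 / (V : ℝ)) * (m : ℝ) ^ 2) := by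
      rw [← Real.exp_nat_mul]
      congr 1
      ring

lemma sum_gaussian_le {b : ℝ} (hb : 0 < b) (n : ℕ) :
    ∑ i ∈ Finset.range n, Real.exp (-b * ((i + 1 : ℕ) : ℝ) ^ 2) ≤ √(Real.pi / b) / 2 := by
  have hanti : AntitoneOn (fun x : ℝ => Real.exp (-b * x ^ 2)) (Set.Icc 0 (0 + (n : ℝ))) := by
    intro x hx y _ hxy
    have hx0 := hx.1
    have hsq : x ^ 2 ≤ y ^ 2 := by gcongr
    exact Real.exp_le_exp.2 (by nlinarith)
  have hsum := hanti.sum_le_integral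
  simp only [zero_add] at hsum
  refine hsum.trans ?_
  rw [intervalIntegral.integral_of_le n.cast_nonneg, ← integral_gaussian_Ioi]
  exact MeasureTheory.setIntegral_mono_set (integrable_exp_neg_mul_sq hb).integrableOn
    (.of_forall fun x => (Real.exp_pos _).le) Set.Ioc_subset_Ioi_self.eventuallyLE

/-- for every `V ≥ 1`, the real sum `Σ_{m=0}^{V} ((V - m)/V)^m` is at most
`2·√V + 1`. -/
theorem stmt10 (V : ℕ) (hV : 1 ≤ V) :
    ∑ m ∈ Finset.range (V + 1), (((V : ℝ) - m) / V) ^ m ≤ 2 * Real.sqrt V + 1 := by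
  have hV0 : (0 : ℝ) < V := by exact_mod_cast hV
  rw [Finset.sum_range_succ', pow_zero]
  gcongr
  calc ∑ i ∈ Finset.range V, (((V : ℝ) - (i + 1 : ℕ)) / V) ^ (i + 1)
      ≤ ∑ i ∈ Finset.range V, Real.exp (-(1 / (V : ℝ)) * ((i + 1 : ℕ) : ℝ) ^ 2) :=
        Finset.sum_le_sum fun i hi => one_sub_div_pow_le_exp hV (Finset.mem_range.1 hi)
    _ ≤ √(Real.pi / (1 / V)) / 2 := sum_gaussian_le (by positivity) V
    _ ≤ 2 * √V := by
      have h : √(Real.pi / (1 / V)) ≤ 2 * √V := by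
        apply Real.sqrt_le_iff.2 ⟨by positivity, ?_⟩
        rw [mul_pow, Real.sq_sqrt hV0.le, div_div_eq_mul_div, div_one]
        nlinarith [Real.pi_le_four]
      linarith [Real.sqrt_nonneg (V : ℝ)]
end
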